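/- arXiv:2410.07704 — 3 statements merged into one kernel-verified Lean document; each statement's English description precedes it below -/
import Mathlib

section
/- Let d, q be positive natural numbers and let F : ℝ^d × ℝ^q → Set(ℝ^d) be a set-valued map that is outer semicontinuous, in the sense that whenever (z_n, θ_n) → (z̄, θ̄) in ℝ^d × ℝ^q, u_n → u in ℝ^d, and u_n ∈ F(z_n, θ_n) for all n, it follows that u ∈ F(z̄, θ̄). Then the set A_conv = {(θ, x) ∈ ℝ^q × (ℕ → ℝ^d) | ∃ z* ∈ ℝ^d with 0 ∈ F(z*, θ) and lim_{n→∞} ‖x n − z*‖ = 0} of pairs of a parameter and a sequence converging to a zero of F(·, θ) is measurable with respect to the product σ-algebra on ℝ^q × (ℕ → ℝ^d). -/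
open Filter Topology

/-- Measurability of the set `A_conv` of pairs `(θ, x)` such that the sequence `x`
converges to a zero of the outer semicontinuous set-valued map `F (·, θ)`. -/
theorem convergent_sequences_set_measurable (d q : ℕ) (hd : 0 < d) (hq : 0 < q)
    (F : EuclideanSpace ℝ (Fin d) × EuclideanSpace ℝ (Fin q) → Set (EuclideanSpace ℝ (Fin d)))
    (hF : ∀ (zs : ℕ → EuclideanSpace ℝ (Fin d)) (θs : ℕ → EuclideanSpace ℝ (Fin q))
        (us : ℕ → EuclideanSpace ℝ (Fin d))
        (zbar : EuclideanSpace ℝ (Fin d)) (θbar : EuclideanSpace ℝ (Fin q))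
        (u : EuclideanSpace ℝ (Fin d)),
        Tendsto zs atTop (𝓝 zbar) → Tendsto θs atTop (𝓝 θbar) → Tendsto us atTop (𝓝 u) →
        (∀ n : ℕ, us n ∈ F (zs n, θs n)) → u ∈ F (zbar, θbar)) :
    MeasurableSet {p : EuclideanSpace ℝ (Fin q) × (ℕ → EuclideanSpace ℝ (Fin d)) |
        ∃ zstar : EuclideanSpace ℝ (Fin d), 0 ∈ F (zstar, p.1) ∧
          Tendsto (fun n : ℕ => ‖p.2 n - zstar‖) atTop (𝓝 0)} := by
  have hC : IsClosed {y : EuclideanSpace ℝ (Fin d) × EuclideanSpace ℝ (Fin q) | 0 ∈ F y} := by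
    refine IsSeqClosed.isClosed ?_
    intro y y0 hy hlim
    exact hF (fun n => (y n).1) (fun n => (y n).2) (fun _ => 0) y0.1 y0.2 0
      ((continuous_fst.tendsto y0).comp hlim) ((continuous_snd.tendsto y0).comp hlim)
      tendsto_const_nhds hy
  have hmeas : ∀ n : ℕ, Measurable
      (fun p : EuclideanSpace ℝ (Fin q) × (ℕ → EuclideanSpace ℝ (Fin d)) => p.2 n) :=
    fun n => (measurable_pi_apply n).comp measurable_snd
  have hE := MeasureTheory.measurableSet_exists_tendsto (l := atTop) hmeas
  have hL := (MeasureTheory.StronglyMeasurable.limUnder (l := atTop)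
    (fun n => (hmeas n).stronglyMeasurable)).measurable
  have hS := hE.inter ((hL.prodMk measurable_fst) hC.measurableSet)
  convert hS using 1
  ext p
  simp only [Set.mem_setOf_eq, Set.mem_inter_iff, Set.mem_preimage]
  constructor
  · rintro ⟨z, hz, hlim⟩
    have h := tendsto_iff_norm_sub_tendsto_zero.2 hlim
    refine ⟨⟨z, h⟩, ?_⟩
    rw [h.limUnder_eq]
    exact hz
  · rintro ⟨h, hz⟩
    exact ⟨_, hz, tendsto_iff_norm_sub_tendsto_zero.1 (tendsto_nhds_limUnder h)⟩
end

section
/- Let P and Z be complete separable (Polish) metric spaces, each equipped with its Borel σ-algebra, and let C ⊆ P × Z be a closed subset of the product metric space. Then the set {(p, x) ∈ P × (ℕ → Z) | ∃ z ∈ Z such that (p, z) ∈ C and x n → z as n → ∞} is measurable with respect to the product of the Borel σ-algebra on P and the product σ-algebra on the sequence space ℕ → Z. -/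
open Filter Topology

/-- For Polish spaces `P`, `Z` and a closed set `C ⊆ P × Z`, the set of pairs
`(p, x)` of a parameter and a sequence converging to some `z` with `(p, z) ∈ C`
is measurable w.r.t. the product of the Borel σ-algebra on `P` and the product
σ-algebra on `ℕ → Z`. -/
theorem convergence_to_closed_set_measurable
    {P Z : Type*}
    [MetricSpace P] [CompleteSpace P] [TopologicalSpace.SeparableSpace P]
    [MeasurableSpace P] [BorelSpace P]
    [MetricSpace Z] [CompleteSpace Z] [TopologicalSpace.SeparableSpace Z]
    [MeasurableSpace Z] [BorelSpace Z]
    (C : Set (P × Z)) (hC : IsClosed C) :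
    MeasurableSet {p : P × (ℕ → Z) |
        ∃ z : Z, (p.1, z) ∈ C ∧ Tendsto (fun n : ℕ => p.2 n) atTop (𝓝 z)} := by
  have : SecondCountableTopology P := UniformSpace.secondCountable_of_separable P
  have : SecondCountableTopology Z := UniformSpace.secondCountable_of_separable Z
  rcases isEmpty_or_nonempty Z with hZ | hZ
  · convert MeasurableSet.empty
    ext p
    simp
  have hf : ∀ n : ℕ, MeasureTheory.StronglyMeasurable (fun p : P × (ℕ → Z) => p.2 n) := fun n =>
    ((measurable_pi_apply n).comp measurable_snd).stronglyMeasurable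
  have h1 := MeasureTheory.StronglyMeasurable.measurableSet_exists_tendsto (l := atTop) hf
  have h2 := (MeasureTheory.StronglyMeasurable.limUnder (l := atTop) hf).measurable
  have h3 : MeasurableSet {p : P × (ℕ → Z) | (p.1, limUnder atTop (fun n => p.2 n)) ∈ C} :=
    (measurable_fst.prodMk h2) hC.measurableSet
  convert h1.inter h3 using 1
  ext p
  constructor
  · rintro ⟨z, hz, ht⟩
    refine ⟨⟨z, ht⟩, ?_⟩
    simpa only [Set.mem_setOf_eq, ht.limUnder_eq] using hz
  · rintro ⟨ht, hz⟩
    exact ⟨_, hz, tendsto_nhds_limUnder ht⟩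
end

section
/- Let H_k = Σ_{j=1}^{k} 1/j denote the k-th harmonic number and consider the sequence x_k = H_k (so x_1 = 1 and x_{k+1} = x_k + 1/(k+1)) and the function f(x) = exp(−x) on ℝ. Then there exists a > 0 such that for every integer k ≥ 1, f(x_{k+1}) + a·(x_{k+1} − x_k)² ≤ f(x_k), i.e. exp(−H_{k+1}) + a/(k+1)² ≤ exp(−H_k); yet x_k → +∞ as k → ∞, so the sequence is unbounded and does not converge. Hence the sufficient-descent condition alone, for a smooth convex function bounded from below, does not imply boundedness or convergence of the sequence. -/
open Filter Topology

/-- The `k`-th harmonic number `H_k = ∑_{j=1}^k 1/j`. -/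
noncomputable def harmonic' (k : ℕ) : ℝ := ∑ j ∈ Finset.range k, 1 / ((j : ℝ) + 1)

/-- Counterexample: the harmonic-number sequence `x_k = H_k` satisfies the
sufficient-descent condition for `f(x) = exp(-x)` (i.e. there is `a > 0` with
`exp(-H_{k+1}) + a/(k+1)² ≤ exp(-H_k)` for all `k ≥ 1`), yet `H_k → +∞`, so the
sequence is unbounded and does not converge. -/
theorem harmonic_sufficient_descent_but_divergent :
    (∃ a : ℝ, 0 < a ∧ ∀ k : ℕ, 1 ≤ k →
        Real.exp (-(harmonic' (k + 1))) + a / ((k : ℝ) + 1) ^ 2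
          ≤ Real.exp (-(harmonic' k))) ∧
    Tendsto harmonic' atTop atTop ∧
    ¬ BddAbove (Set.range harmonic') ∧
    ¬ ∃ L : ℝ, Tendsto harmonic' atTop (𝓝 L) := by
  have htop : Tendsto harmonic' atTop atTop :=
    Real.tendsto_sum_range_one_div_nat_succ_atTop
  refine ⟨⟨Real.exp (-1), Real.exp_pos _, ?_⟩, htop, ?_, ?_⟩
  · intro k _
    have hk : (0 : ℝ) < (k : ℝ) + 1 := by positivity
    have hH : harmonic' (k + 1) ≤ 1 + Real.log ((k : ℝ) + 1) := by
      have h := harmonic_le_one_add_log (k + 1)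
      have e : harmonic' (k + 1) = ((harmonic (k + 1) : ℚ) : ℝ) := by
        simp [harmonic', harmonic]
      rw [e]
      simpa using h
    have hs : harmonic' (k + 1) = harmonic' k + 1 / ((k : ℝ) + 1) := by
      simp only [harmonic', Finset.sum_range_succ]
    have h1 : Real.exp (-1) / ((k : ℝ) + 1) ≤ Real.exp (-(harmonic' (k + 1))) := by
      calc Real.exp (-1) / ((k : ℝ) + 1)
          = Real.exp (-1 - Real.log ((k : ℝ) + 1)) := by
            rw [Real.exp_sub, Real.exp_log hk]
        _ ≤ _ := Real.exp_le_exp.mpr (by linarith)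
    have h2 : Real.exp (-(harmonic' k))
        = Real.exp (-(harmonic' (k + 1))) * Real.exp (1 / ((k : ℝ) + 1)) := by
      rw [← Real.exp_add, hs]
      congr 1
      ring
    have h3 := Real.add_one_le_exp (1 / ((k : ℝ) + 1))
    have h4 := mul_le_mul_of_nonneg_left h3 (Real.exp_pos (-(harmonic' (k + 1)))).le
    have h5 := mul_le_mul_of_nonneg_right h1 (one_div_pos.mpr hk).le
    have h6 : Real.exp (-1) / ((k : ℝ) + 1) ^ 2
        = Real.exp (-1) / ((k : ℝ) + 1) * (1 / ((k : ℝ) + 1)) := by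
      field_simp
    rw [h2, h6]
    linarith
  · exact not_bddAbove_of_tendsto_atTop htop
  · rintro ⟨L, hL⟩
    exact not_tendsto_nhds_of_tendsto_atTop htop L hL
end
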